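/- (Uninterrupted Closing Theorem) In a regular run, the closing of the gate is never interrupted: if Dir is set to close at some moment α (i.e., Dir(α) = open and Dir(α+) = close), then Dir(t) = close for every t in the interval (α, α + d_close). -/

import Mathlib

namespace RailCross

inductive TStat : Type
  | emp | coming | incrossing
deriving DecidableEq

inductive DirV : Type
  | opn | cls
deriving DecidableEq

inductive GateV : Type
  | opened | closed
deriving DecidableEq

/-- `f` is piecewise constant on `[0, ∞)`: for every `τ > 0` there is a finite
partition `0 = s 0 < s 1 < … < s n = τ` such that `f` is constant on each open
subinterval `(s i, s (i+1))`. -/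
def PWC {Y : Type*} (f : ℝ → Y) : Prop :=
  ∀ τ : ℝ, 0 < τ → ∃ n : ℕ, ∃ s : ℕ → ℝ,
    s 0 = 0 ∧ s n = τ ∧ (∀ i < n, s i < s (i + 1)) ∧
    (∀ i < n, ∀ a b : ℝ, s i < a → a < b → b < s (i + 1) → f a = f b)

/-- `v` is the right-hand value `f(t+)`: `f` is constantly `v` on some `(t, t+ε)`. -/
def RightVal {Y : Type*} (f : ℝ → Y) (t : ℝ) (v : Y) : Prop :=
  ∃ ε : ℝ, 0 < ε ∧ ∀ u : ℝ, t < u → u < t + ε → f u = v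

/-- `v` is the left-hand value `f(t−)` (for `t > 0`): `f` is constantly `v` on some `(t-ε, t)`. -/
def LeftVal {Y : Type*} (f : ℝ → Y) (t : ℝ) (v : Y) : Prop :=
  ∃ ε : ℝ, 0 < ε ∧ ε ≤ t ∧ ∀ u : ℝ, t - ε < u → u < t → f u = v

/-- `tm` is the (finite or infinite) increasing sequence of significant moments of a
track with status function `f`; a finite sequence is encoded by letting `tm` take the
value `⊤ = ∞` from some point on. -/
structure TrainMotion (dmin dmax : ℝ) (f : ℝ → TStat) (tm : ℕ → EReal) : Prop where
  zero : tm 0 = 0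
  mono : Monotone tm
  strict : ∀ i, tm i ≠ ⊤ → tm i < tm (i + 1)
  last_div : ∀ k, tm k ≠ ⊤ → tm (k + 1) = ⊤ → 3 ∣ k
  status_empty : ∀ i : ℕ, ∀ u : ℝ, tm (3 * i) ≤ (u : EReal) → (u : EReal) < tm (3 * i + 1) →
    f u = TStat.emp
  status_coming : ∀ i : ℕ, ∀ u : ℝ, tm (3 * i + 1) ≤ (u : EReal) → (u : EReal) < tm (3 * i + 2) →
    f u = TStat.coming
  status_cross : ∀ i : ℕ, ∀ u : ℝ, tm (3 * i + 2) ≤ (u : EReal) → (u : EReal) < tm (3 * i + 3) →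
    f u = TStat.incrossing
  gap : ∀ i : ℕ, ∀ a b : ℝ, tm (3 * i + 1) = (a : EReal) → tm (3 * i + 2) = (b : EReal) →
    dmin ≤ b - a ∧ b - a ≤ dmax

/-- `SafeToOpen(t)`: every track is empty or its deadline is more than `dopen` away. -/
def SafeToOpen {Tracks : Type*} (dopen : ℝ) (trackStatus : Tracks → ℝ → TStat)
    (deadline : Tracks → ℝ → EReal) (t : ℝ) : Prop :=
  ∀ x : Tracks, trackStatus x t = TStat.emp ∨ ((t + dopen : ℝ) : EReal) < deadline x t

/-- A regular run of the railroad-crossing evolving algebra.  `WaitTime = dmin - dclose`. -/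
structure RegularRun (Tracks : Type*) (dmin dmax dopen dclose : ℝ) where
  trackStatus : Tracks → ℝ → TStat
  deadline : Tracks → ℝ → EReal
  dir : ℝ → DirV
  gate : ℝ → GateV
  /-- the right-hand value `Deadline(x, t+)` -/
  deadlinePlus : Tracks → ℝ → EReal
  /-- the right-hand value `Dir(t+)` -/
  dirPlus : ℝ → DirV
  /-- the right-hand value `GateStatus(t+)` -/
  gatePlus : ℝ → GateV
  pwc_ts : ∀ x, PWC (trackStatus x)
  pwc_dl : ∀ x, PWC (deadline x)
  pwc_dir : PWC dir
  pwc_gate : PWC gate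
  dlPlus_spec : ∀ x, ∀ t : ℝ, 0 ≤ t → RightVal (deadline x) t (deadlinePlus x t)
  dirPlus_spec : ∀ t : ℝ, 0 ≤ t → RightVal dir t (dirPlus t)
  gatePlus_spec : ∀ t : ℝ, 0 ≤ t → RightVal gate t (gatePlus t)
  dl_left : ∀ x, ∀ t : ℝ, 0 < t → LeftVal (deadline x) t (deadline x t)
  dir_left : ∀ t : ℝ, 0 < t → LeftVal dir t (dir t)
  gate_left : ∀ t : ℝ, 0 < t → LeftVal gate t (gate t)
  trainMotion : ∀ x, ∃ tm : ℕ → EReal, TrainMotion dmin dmax (trackStatus x) tm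
  dl_init : ∀ x, deadline x 0 = ⊤
  dir_init : dir 0 = DirV.opn
  gate_init : gate 0 = GateV.opened
  dl_step_coming : ∀ x, ∀ t : ℝ, 0 ≤ t → trackStatus x t = TStat.coming → deadline x t = ⊤ →
    deadlinePlus x t = ((t + (dmin - dclose) : ℝ) : EReal)
  dl_step_empty : ∀ x, ∀ t : ℝ, 0 ≤ t → trackStatus x t = TStat.emp → deadline x t ≠ ⊤ →
    deadlinePlus x t = ⊤
  dl_step_other : ∀ x, ∀ t : ℝ, 0 ≤ t →
    ¬(trackStatus x t = TStat.coming ∧ deadline x t = ⊤) →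
    ¬(trackStatus x t = TStat.emp ∧ deadline x t ≠ ⊤) →
    deadlinePlus x t = deadline x t
  dir_step_close : ∀ t : ℝ, 0 ≤ t → (∃ x, deadline x t = (t : EReal)) → dirPlus t = DirV.cls
  dir_step_open : ∀ t : ℝ, 0 ≤ t → (∀ x, deadline x t ≠ (t : EReal)) → dir t = DirV.cls →
    SafeToOpen dopen trackStatus deadline t → dirPlus t = DirV.opn
  dir_step_other : ∀ t : ℝ, 0 ≤ t → (∀ x, deadline x t ≠ (t : EReal)) →
    ¬(dir t = DirV.cls ∧ SafeToOpen dopen trackStatus deadline t) → dirPlus t = dir t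
  gate_step : ∀ t : ℝ, 0 ≤ t →
    gatePlus t = gate t ∨ (dir t = DirV.opn ∧ gatePlus t = GateV.opened) ∨
      (dir t = DirV.cls ∧ gatePlus t = GateV.closed)
  gate_close_bound : ∀ t : ℝ, 0 ≤ t →
    ¬(∀ u ∈ Set.Ioo t (t + dclose), dir u = DirV.cls ∧ gate u = GateV.opened)
  gate_open_bound : ∀ t : ℝ, 0 ≤ t →
    ¬(∀ u ∈ Set.Ioo t (t + dopen), dir u = DirV.opn ∧ gate u = GateV.closed)

/-- Real induction: if `f` takes the value `v` just after `p`, is left-continuous, and never leaves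
`v` strictly between `p` and `q`, then `f q = v`. -/
theorem eq_of_rightVal_of_step {Y : Type*} {f fp : ℝ → Y} {p q : ℝ} {v : Y} (hp : 0 ≤ p)
    (hpq : p < q) (hR : ∀ t, 0 ≤ t → RightVal f t (fp t)) (hL : ∀ t, 0 < t → LeftVal f t (f t))
    (hv : fp p = v) (hstep : ∀ u, p < u → u < q → f u = v → fp u = v) : f q = v := by
  by_contra hq
  set S : Set ℝ := {t | p < t ∧ t ≤ q ∧ f t ≠ v} with hS
  have hqS : q ∈ S := ⟨hpq, le_rfl, hq⟩
  have hbdd : BddBelow S := ⟨p, fun t ht => ht.1.le⟩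
  have hsq : sInf S ≤ q := csInf_le hbdd hqS
  obtain ⟨ε, hε, hr⟩ := hR p hp
  have hps : p < sInf S := by
    refine lt_of_lt_of_le (lt_add_of_pos_right p hε) (le_csInf ⟨q, hqS⟩ fun t ht => ?_)
    by_contra! hlt
    exact ht.2.2 ((hr t ht.1 hlt).trans hv)
  have hgood : ∀ u, p < u → u < sInf S → f u = v := fun u hpu hus => by
    by_contra hne
    exact absurd (csInf_le hbdd ⟨hpu, (hus.trans_le hsq).le, hne⟩) (not_le.mpr hus)
  have hfs : f (sInf S) = v := by
    obtain ⟨δ, hδ, -, hl⟩ := hL _ (hp.trans_lt hps)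
    obtain ⟨u, hu, hus⟩ := exists_between (max_lt hps (sub_lt_self (sInf S) hδ))
    rw [← hl u ((le_max_right _ _).trans_lt hu) hus]
    exact hgood u ((le_max_left _ _).trans_lt hu) hus
  have hlt : sInf S < q := lt_of_le_of_ne hsq fun h => hq (h ▸ hfs)
  obtain ⟨δ, hδ, hr'⟩ := hR _ (hp.trans hps.le)
  have hle : sInf S + δ ≤ sInf S := le_csInf ⟨q, hqS⟩ fun t ht => by
    by_contra! hlt'
    rcases (csInf_le hbdd ht).lt_or_eq with h | h
    · exact ht.2.2 ((hr' t h hlt').trans (hstep _ hps hlt hfs))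
    · exact ht.2.2 (h ▸ hfs)
  linarith

namespace TrainMotion

variable {dmin dmax : ℝ} {f : ℝ → TStat} {tm : ℕ → EReal}

theorem nonneg (h : TrainMotion dmin dmax f tm) (k : ℕ) : 0 ≤ tm k :=
  h.zero ▸ h.mono (Nat.zero_le k)

theorem exists_coe (h : TrainMotion dmin dmax f tm) {k : ℕ} (hk : tm k ≠ ⊤) :
    ∃ a : ℝ, 0 ≤ a ∧ tm k = a := by
  have hbot : tm k ≠ ⊥ := fun hb => by simpa [hb] using h.nonneg k
  refine ⟨(tm k).toReal, EReal.toReal_nonneg (h.nonneg k), (EReal.coe_toReal hk hbot).symm⟩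

theorem coming_add_le (h : TrainMotion dmin dmax f tm) {i : ℕ} {a : ℝ} (ha : tm (3 * i + 1) = a) :
    ((a + dmin : ℝ) : EReal) ≤ tm (3 * i + 2) := by
  by_cases ht : tm (3 * i + 2) = ⊤
  · simp [ht]
  · obtain ⟨b, -, hb⟩ := h.exists_coe ht
    rw [hb, EReal.coe_le_coe_iff]
    linarith [(h.gap i a b ha hb).1]

theorem mul_le (h : TrainMotion dmin dmax f tm) (n : ℕ) :
    ((n * dmin : ℝ) : EReal) ≤ tm (3 * n) := by
  induction n with
  | zero => simp [h.zero]
  | succ n ih =>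
    have h23 : tm (3 * n + 2) ≤ tm (3 * (n + 1)) := h.mono (by lia)
    by_cases ht : tm (3 * n + 1) = ⊤
    · have h13 : tm (3 * n + 1) ≤ tm (3 * (n + 1)) := h.mono (by lia)
      rw [ht, top_le_iff] at h13
      simp [h13]
    · obtain ⟨a, -, ha⟩ := h.exists_coe ht
      have hna : n * dmin ≤ a := by
        rw [← EReal.coe_le_coe_iff, ← ha]
        exact ih.trans (h.mono (Nat.le_succ _))
      refine le_trans ?_ ((h.coming_add_le ha).trans h23)
      rw [EReal.coe_le_coe_iff]
      push_cast
      linarith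

theorem exists_lt_le (h : TrainMotion dmin dmax f tm) (hd : 0 < dmin) {t : ℝ} (ht : 0 < t) :
    ∃ k, tm k < t ∧ (t : EReal) ≤ tm (k + 1) := by
  by_contra! hcon
  have hall : ∀ k, tm k < t := fun k => by
    induction k with
    | zero => rw [h.zero]; exact_mod_cast ht
    | succ k ih => exact hcon k ih
  obtain ⟨n, hn⟩ := Archimedean.arch t hd
  rw [nsmul_eq_mul] at hn
  exact absurd ((EReal.coe_le_coe_iff.mpr hn).trans (h.mul_le n)) (not_le.mpr (hall _))

theorem ne_emp (h : TrainMotion dmin dmax f tm) {i : ℕ} {u : ℝ} (h1 : tm (3 * i + 1) ≤ u)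
    (h3 : (u : EReal) < tm (3 * i + 3)) : f u ≠ TStat.emp := by
  rcases lt_or_ge (u : EReal) (tm (3 * i + 2)) with h2 | h2
  · simp [h.status_coming i u h1 h2]
  · simp [h.status_cross i u h2 h3]

end TrainMotion

namespace RegularRun

variable {Tracks : Type*} {dmin dmax dopen dclose : ℝ}
  (R : RegularRun Tracks dmin dmax dopen dclose) {x : Tracks} {tm : ℕ → EReal}

theorem deadlinePlus_of_emp {t : ℝ} (ht : 0 ≤ t) (he : R.trackStatus x t = TStat.emp) :
    R.deadlinePlus x t = ⊤ := by
  by_cases hd : R.deadline x t = ⊤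
  · rw [R.dl_step_other x t ht (by simp [he]) (by simp [hd]), hd]
  · exact R.dl_step_empty x t ht he hd

theorem deadline_of_emp (h : TrainMotion dmin dmax (R.trackStatus x) tm) {i : ℕ} {q : ℝ}
    (h0 : tm (3 * i) < q) (h1 : (q : EReal) ≤ tm (3 * i + 1)) : R.deadline x q = ⊤ := by
  obtain ⟨p, hp0, hp⟩ := h.exists_coe (ne_top_of_lt h0)
  have hpq : p < q := by rwa [hp, EReal.coe_lt_coe_iff] at h0
  have hplus : ∀ u, p ≤ u → u < q → R.deadlinePlus x u = ⊤ := fun u hpu huq =>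
    R.deadlinePlus_of_emp (hp0.trans hpu) (h.status_empty i u
      (hp ▸ EReal.coe_le_coe_iff.mpr hpu) ((EReal.coe_lt_coe_iff.mpr huq).trans_le h1))
  exact eq_of_rightVal_of_step hp0 hpq (R.dlPlus_spec x) (R.dl_left x) (hplus p le_rfl hpq)
    fun u hpu huq _ => hplus u hpu.le huq

theorem deadline_of_coming (h : TrainMotion dmin dmax (R.trackStatus x) tm) {i : ℕ} {a q : ℝ}
    (ha : tm (3 * i + 1) = a) (haq : a < q) (hq : (q : EReal) ≤ tm (3 * i + 3)) :
    R.deadline x q = ((a + (dmin - dclose) : ℝ) : EReal) := by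
  have ha0 : 0 ≤ a := by
    have := h.nonneg (3 * i + 1)
    rw [ha] at this
    exact_mod_cast this
  have hne : tm (3 * i + 1) ≠ ⊤ := by simp [ha]
  have h01 : tm (3 * i) < tm (3 * i + 1) :=
    h.strict _ (ne_top_of_le_ne_top hne (h.mono (Nat.le_succ _)))
  have htop : R.deadline x a = ⊤ := R.deadline_of_emp h (ha ▸ h01) ha.ge
  have hcom : R.trackStatus x a = TStat.coming :=
    h.status_coming i a ha.le (ha ▸ h.strict _ hne)
  refine eq_of_rightVal_of_step ha0 haq (R.dlPlus_spec x) (R.dl_left x)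
    (R.dl_step_coming x a ha0 hcom htop) fun u hau huq hu => ?_
  have hemp : R.trackStatus x u ≠ TStat.emp :=
    h.ne_emp (ha ▸ EReal.coe_le_coe_iff.mpr hau.le) ((EReal.coe_lt_coe_iff.mpr huq).trans_le hq)
  have hfin : R.deadline x u ≠ ⊤ := hu ▸ EReal.coe_ne_top _
  rw [R.dl_step_other x u (ha0.trans hau.le) (by simp [hfin]) (by simp [hemp]), hu]

/-- A deadline reached at time `t` is kept, with the track occupied, during `[t, t + dclose)`. -/
theorem deadline_eq_and_ne_emp (hdmin : 0 < dmin) {t u : ℝ} (ht : 0 ≤ t)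
    (hx : R.deadline x t = t) (htu : t ≤ u) (hu : u < t + dclose) :
    R.deadline x u = t ∧ R.trackStatus x u ≠ TStat.emp := by
  obtain ⟨tm, h⟩ := R.trainMotion x
  have ht0 : 0 < t := ht.lt_of_ne fun h0 => by
    rw [← h0, R.dl_init x] at hx
    exact EReal.coe_ne_top _ hx.symm
  obtain ⟨k, hk, hk'⟩ := h.exists_lt_le hdmin ht0
  have hdiv := Nat.div_add_mod k 3
  set i := k / 3
  by_cases hk0 : k = 3 * i
  · rw [hk0] at hk hk'
    rw [R.deadline_of_emp h hk hk'] at hx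
    exact absurd hx.symm (EReal.coe_ne_top _)
  have h1 : tm (3 * i + 1) < t := (h.mono (by lia)).trans_lt hk
  have h3 : (t : EReal) ≤ tm (3 * i + 3) := hk'.trans (h.mono (by lia))
  obtain ⟨a, -, ha⟩ := h.exists_coe (ne_top_of_lt h1)
  rw [ha, EReal.coe_lt_coe_iff] at h1
  have hat : a + (dmin - dclose) = t := by
    rwa [R.deadline_of_coming h ha h1 h3, EReal.coe_eq_coe_iff] at hx
  have hu3 : (u : EReal) < tm (3 * i + 3) := by
    refine lt_of_lt_of_le ?_ ((h.coming_add_le ha).trans (h.mono (Nat.le_succ _)))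
    rw [EReal.coe_lt_coe_iff]
    linarith
  refine ⟨?_, h.ne_emp (ha ▸ EReal.coe_le_coe_iff.mpr (h1.le.trans htu)) hu3⟩
  rw [R.deadline_of_coming h ha (h1.trans_le htu) hu3.le, hat]

theorem exists_deadline_eq_of_dir_set_close {t : ℝ} (ht : 0 ≤ t) (h1 : R.dir t = DirV.opn)
    (h2 : R.dirPlus t = DirV.cls) : ∃ x, R.deadline x t = t := by
  by_contra! hno
  rw [R.dir_step_other t ht hno (by simp [h1]), h1] at h2
  cases h2

end RegularRun

theorem uninterrupted_closing {Tracks : Type*} [Fintype Tracks] [Nonempty Tracks]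
    {dmin dmax dopen dclose : ℝ}
    (hdmin : 0 < dmin) (hdmax : 0 < dmax) (hdopen : 0 < dopen) (hdclose : 0 < dclose)
    (hcm : dclose < dmin) (hmm : dmin ≤ dmax)
    (R : RegularRun Tracks dmin dmax dopen dclose)
    (α : ℝ) (hα : 0 ≤ α)
    (h1 : R.dir α = DirV.opn) (h2 : R.dirPlus α = DirV.cls) :
    ∀ t ∈ Set.Ioo α (α + dclose), R.dir t = DirV.cls := by
  rintro t ⟨hαt, htc⟩
  obtain ⟨x, hx⟩ := R.exists_deadline_eq_of_dir_set_close hα h1 h2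
  refine eq_of_rightVal_of_step hα hαt R.dirPlus_spec R.dir_left h2 fun u hαu hut hu => ?_
  have hu0 : 0 ≤ u := hα.trans hαu.le
  by_cases hdl : ∃ y, R.deadline y u = u
  · exact R.dir_step_close u hu0 hdl
  obtain ⟨hxu, hemp⟩ := R.deadline_eq_and_ne_emp hdmin hα hx hαu.le (hut.trans htc)
  rw [R.dir_step_other u hu0 (not_exists.mp hdl) ?_, hu]
  rintro ⟨-, hsafe⟩
  rcases hsafe x with h | h
  · exact hemp h
  · rw [hxu, EReal.coe_lt_coe_iff] at h
    linarith

end RailCross
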